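/- For every n ≥ 1 and all z ∈ F_{q^n} and all x, y ∈ F_{q^n} with x ≠ y, one has in St ⊗_k St: [D_{q^n}]·[U_{q^n}]·ω_{z,z} = (q^n − 1)·[U_{q^n}]·ω_{0,0}, and [D_{q^n}]·[U_{q^n}]·ω_{x,y} = ([U_{q^n}]·η) ⊗ ([U_{q^n}]·η) − [U_{q^n}]·ω_{0,0}. -/

import Mathlib

noncomputable section

open scoped TensorProduct

namespace SL2X

variable (p : ℕ) [Fact p.Prime]

/-- The algebraic closure of the prime field `𝔽_p`. -/
abbrev F : Type := AlgebraicClosure (ZMod p)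

/-- `G = SL₂(F)`. -/
abbrev G : Type := Matrix.SpecialLinearGroup (Fin 2) (F p)

/-- The unipotent element `ε(x) = [[1,x],[0,1]]`. -/
def eps (x : F p) : G p :=
  ⟨!![1, x; 0, 1], by simp [Matrix.det_fin_two_of]⟩

/-- The torus element `h(t) = diag(t, t⁻¹)`. -/
def h (t : (F p)ˣ) : G p :=
  ⟨!![(t : F p), 0; 0, ((t⁻¹ : (F p)ˣ) : F p)], by simp [Matrix.det_fin_two_of]⟩

/-- The Weyl element `s = [[0,1],[-1,0]]`. -/
def sG : G p :=
  ⟨!![0, 1; -1, 0], by simp [Matrix.det_fin_two_of]⟩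

/-- The Borel subgroup `B` of upper triangular matrices in `G`. -/
def B : Subgroup (G p) where
  carrier := {g | (g : Matrix (Fin 2) (Fin 2) (F p)) 1 0 = 0}
  one_mem' := by simp [Matrix.one_apply]
  mul_mem' := by
    intro a b ha hb
    simp only [Set.mem_setOf_eq] at *
    simp [Matrix.mul_apply, Fin.sum_univ_two, ha, hb]
  inv_mem' := by
    intro a ha
    simp only [Set.mem_setOf_eq] at *
    simp [Matrix.SpecialLinearGroup.coe_inv, Matrix.adjugate_fin_two, ha]

/-- The diagonal part of an element of `B`, as a unit of `F`. -/
def Bdiag (b : B p) : (F p)ˣ where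
  val := ((b : G p) : Matrix (Fin 2) (Fin 2) (F p)) 0 0
  inv := ((b : G p) : Matrix (Fin 2) (Fin 2) (F p)) 1 1
  val_inv := by
    have hdet : ((b : G p) : Matrix (Fin 2) (Fin 2) (F p)).det = 1 := (b : G p).2
    have h10 : ((b : G p) : Matrix (Fin 2) (Fin 2) (F p)) 1 0 = 0 := b.2
    rw [Matrix.det_fin_two, h10, mul_zero, sub_zero] at hdet
    exact hdet
  inv_val := by
    have hdet : ((b : G p) : Matrix (Fin 2) (Fin 2) (F p)).det = 1 := (b : G p).2
    have h10 : ((b : G p) : Matrix (Fin 2) (Fin 2) (F p)) 1 0 = 0 := b.2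
    rw [Matrix.det_fin_two, h10, mul_zero, sub_zero] at hdet
    rw [mul_comm]; exact hdet

variable (k : Type) [Field k] [IsAlgClosed k] [CharZero k]

/-- The group algebra `kG`. -/
abbrev kG : Type := MonoidAlgebra k (G p)

/-- The canonical image of a group element in the group algebra. -/
def γ (g : G p) : kG p k := MonoidAlgebra.of k (G p) g

/-- The submodule of relations defining the induced module
`M(θ) = kG ⊗_{kB} k_θ`, where the character `θ` of `T ≅ Fˣ` is extended to `B`
by letting `U` act trivially. -/
def Nmod (θ : (F p)ˣ →* kˣ) : Submodule (kG p k) (kG p k) :=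
  Submodule.span (kG p k)
    {y | ∃ b : B p, y = γ p k (b : G p) - ((θ (Bdiag p b) : k)) • (1 : kG p k)}

/-- The induced module `M(θ) = kG ⊗_{kB} k_θ`, realized as `kG / N(θ)` where
`N(θ)` is the left submodule generated by the elements `b - θ(b)·1`, `b ∈ B`. -/
def Mmod (θ : (F p)ˣ →* kˣ) : Type := kG p k ⧸ Nmod p k θ

instance (θ : (F p)ˣ →* kˣ) : AddCommGroup (Mmod p k θ) :=
  inferInstanceAs (AddCommGroup (kG p k ⧸ Nmod p k θ))
instance (θ : (F p)ˣ →* kˣ) : Module (kG p k) (Mmod p k θ) :=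
  inferInstanceAs (Module (kG p k) (kG p k ⧸ Nmod p k θ))
instance (θ : (F p)ˣ →* kˣ) : Module k (Mmod p k θ) :=
  inferInstanceAs (Module k (kG p k ⧸ Nmod p k θ))
instance (θ : (F p)ˣ →* kˣ) : IsScalarTower k (kG p k) (Mmod p k θ) :=
  inferInstanceAs (IsScalarTower k (kG p k) (kG p k ⧸ Nmod p k θ))

/-- The canonical generator `1_θ ∈ M(θ)`. -/
def oneθ (θ : (F p)ˣ →* kˣ) : Mmod p k θ :=
  Submodule.Quotient.mk (1 : kG p k)

/-- `η = (1 - s)·1_tr ∈ M(tr)`. -/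
def eta : Mmod p k 1 :=
  Submodule.Quotient.mk ((1 : kG p k) - γ p k (sG p))

/-- The Steinberg module `St = kG·η ⊆ M(tr)`. -/
def St : Submodule (kG p k) (Mmod p k 1) :=
  Submodule.span (kG p k) {eta p k}

/-- `ε(x)·η` as an element of `St`. -/
def E (x : F p) : ↥(St p k) :=
  ⟨γ p k (eps p x) • eta p k,
    Submodule.smul_mem _ _ (Submodule.mem_span_singleton_self _)⟩

/-- The action of a group element on `St`, as a `k`-linear map. -/
def gSt (g : G p) : ↥(St p k) →ₗ[k] ↥(St p k) where
  toFun v := ⟨γ p k g • (v : Mmod p k 1), Submodule.smul_mem _ _ v.2⟩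
  map_add' := by intro a b; apply Subtype.ext; simp [smul_add]
  map_smul' := by
    intro c v; apply Subtype.ext
    simp [smul_comm (γ p k g) c]

/-- `St ⊗_k St`. -/
abbrev StT : Type := ↥(St p k) ⊗[k] ↥(St p k)

/-- The diagonal action of a group element on `St ⊗_k St`. -/
def gTT (g : G p) : StT p k →ₗ[k] StT p k :=
  TensorProduct.map (gSt p k g) (gSt p k g)

/-- `ω_{x,y} = (ε(x)η ⊗ ε(y)η + ε(y)η ⊗ ε(x)η)/2`. -/
def ω (x y : F p) : StT p k :=
  (2 : k)⁻¹ • (E p k x ⊗ₜ[k] E p k y + E p k y ⊗ₜ[k] E p k x)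

/-- `ρ_{x,y} = (ε(x)η ⊗ ε(y)η − ε(y)η ⊗ ε(x)η)/2`. -/
def ρ (x y : F p) : StT p k :=
  (2 : k)⁻¹ • (E p k x ⊗ₜ[k] E p k y - E p k y ⊗ₜ[k] E p k x)

/-- `V₊`, the span of the `ω_{x,y}`. -/
def Vplus : Submodule k (StT p k) :=
  Submodule.span k {v | ∃ x y : F p, v = ω p k x y}

/-- `V₋`, the span of the `ρ_{x,y}` for `x ≠ y`. -/
def Vminus : Submodule k (StT p k) :=
  Submodule.span k {v | ∃ x y : F p, x ≠ y ∧ v = ρ p k x y}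

lemma _root_.Subfield.sum_mul_add_left {K M : Type*} [Field K] [AddCommMonoid M]
    (L : Subfield K) (S : Finset K) (hS : ∀ x, x ∈ S ↔ x ∈ L) (f : K → M)
    {c d : K} (hc : c ∈ L) (hc0 : c ≠ 0) (hd : d ∈ L) :
    ∑ u ∈ S, f (c * (u + d)) = ∑ v ∈ S, f v := by
  refine Finset.sum_nbij' (fun u => c * (u + d)) (fun v => c⁻¹ * v - d) ?_ ?_ ?_ ?_ ?_
  · intro u hu
    rw [hS] at hu ⊢
    exact L.mul_mem hc (L.add_mem hu hd)
  · intro v hv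
    rw [hS] at hv ⊢
    exact L.sub_mem (L.mul_mem (L.inv_mem hc) hv) hd
  · intro u _
    field_simp
    ring
  · intro v _
    field_simp
    ring
  · intros
    rfl

open Classical in
lemma _root_.Subfield.sum_erase_zero_sum_mul_add {K M : Type*} [Field K] [AddCommMonoid M]
    (L : Subfield K) (S : Finset K) (hS : ∀ x, x ∈ S ↔ x ∈ L) (f : K → K → M)
    {a b : K} (ha : a ∈ L) (hb : b ∈ L) (hab : a ≠ b) :
    ∑ c ∈ S.erase 0, ∑ u ∈ S, f (c * (u + a)) (c * (u + b)) =
      ∑ v ∈ S, ∑ w ∈ S.erase v, f v w := by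
  have hba : b - a ≠ 0 := sub_ne_zero.mpr hab.symm
  have hinner : ∀ c ∈ S.erase 0, ∑ u ∈ S, f (c * (u + a)) (c * (u + b)) =
      ∑ v ∈ S, f v (v + c * (b - a)) := by
    intro c hc
    rw [Finset.mem_erase, hS] at hc
    rw [← L.sum_mul_add_left S hS (fun v => f v (v + c * (b - a))) hc.2 hc.1 ha]
    refine Finset.sum_congr rfl fun u _ => ?_
    congr 1
    ring
  rw [Finset.sum_congr rfl hinner, Finset.sum_comm]
  refine Finset.sum_congr rfl fun v hv => ?_
  rw [hS] at hv
  refine Finset.sum_nbij' (fun c => v + c * (b - a)) (fun w => (w - v) * (b - a)⁻¹)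
    ?_ ?_ ?_ ?_ ?_
  · intro c hc
    rw [Finset.mem_erase, hS] at hc ⊢
    refine ⟨?_, L.add_mem hv (L.mul_mem hc.2 (L.sub_mem hb ha))⟩
    simpa using ⟨hc.1, hba⟩
  · intro w hw
    rw [Finset.mem_erase, hS] at hw ⊢
    exact ⟨mul_ne_zero (sub_ne_zero.mpr hw.1) (inv_ne_zero hba),
      L.mul_mem (L.sub_mem hw.2 hv) (L.inv_mem (L.sub_mem hb ha))⟩
  · intro c _
    field_simp
    ring
  · intro w _
    field_simp
    ring
  · intros
    rfl

/-- A finite set consisting of the roots of `X ^ p ^ m - X` in `F` has `p ^ m` elements. -/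
lemma card_eq_of_mem_iff_pow_eq (S : Finset (F p)) {m : ℕ} (hm : m ≠ 0)
    (hS : ∀ x : F p, x ∈ S ↔ x ^ p ^ m = x) : S.card = p ^ m := by
  classical
  have hp : 1 < p ^ m := Nat.one_lt_pow hm (Fact.out : p.Prime).one_lt
  set P : Polynomial (F p) := Polynomial.X ^ p ^ m - Polynomial.X with hP
  have hP0 : P ≠ 0 := FiniteField.X_pow_card_sub_X_ne_zero _ hp
  have hsep : P.Separable := galois_poly_separable p (p ^ m) (dvd_pow_self p hm)
  have hSr : S = P.roots.toFinset := by
    ext x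
    rw [hS, Multiset.mem_toFinset, Polynomial.mem_roots hP0, Polynomial.IsRoot, hP,
      Polynomial.eval_sub, Polynomial.eval_pow, Polynomial.eval_X, sub_eq_zero]
  rw [hSr, Multiset.toFinset_card_of_nodup (Polynomial.nodup_roots hsep),
    Polynomial.splits_iff_card_roots.mp (IsAlgClosed.splits P), hP,
    FiniteField.X_pow_card_sub_X_natDegree_eq _ hp]

/-- The fixed field of the `m`-th iterate of the Frobenius of `F`. -/
def frobeniusFixed (m : ℕ) : Subfield (F p) :=
  (iterateFrobenius (F p) p m).eqLocusField (RingHom.id (F p))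

lemma mem_frobeniusFixed {m : ℕ} {x : F p} : x ∈ frobeniusFixed p m ↔ x ^ p ^ m = x :=
  Iff.rfl

lemma γ_mul (g g' : G p) : γ p k (g * g') = γ p k g * γ p k g' :=
  map_mul _ _ _

lemma γ_smul_smul (g g' : G p) (v : Mmod p k 1) :
    γ p k g • γ p k g' • v = γ p k (g * g') • v := by
  rw [γ_mul, mul_smul]

lemma eps_mul_eps (x y : F p) : eps p x * eps p y = eps p (x + y) := by
  apply Subtype.ext
  change !![1, x; 0, 1] * !![1, y; 0, 1] = !![1, x + y; 0, 1]
  simp [add_comm]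

lemma h_mul_eps (t : (F p)ˣ) (x : F p) :
    h p t * eps p x = eps p ((t : F p) ^ 2 * x) * h p t := by
  apply Subtype.ext
  change !![(t : F p), 0; 0, ((t⁻¹ : (F p)ˣ) : F p)] * !![1, x; 0, 1] =
    !![1, (t : F p) ^ 2 * x; 0, 1] * !![(t : F p), 0; 0, ((t⁻¹ : (F p)ˣ) : F p)]
  simp
  field_simp

lemma h_mul_sG (t : (F p)ˣ) : h p t * sG p = sG p * h p t⁻¹ := by
  apply Subtype.ext
  change !![(t : F p), 0; 0, ((t⁻¹ : (F p)ˣ) : F p)] * !![0, 1; -1, 0] =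
    !![0, 1; -1, 0] * !![((t⁻¹ : (F p)ˣ) : F p), 0; 0, ((t⁻¹⁻¹ : (F p)ˣ) : F p)]
  simp

lemma γ_h_sub_one_mem (t : (F p)ˣ) : γ p k (h p t) - 1 ∈ Nmod p k 1 := by
  refine Submodule.subset_span ⟨⟨h p t, rfl⟩, ?_⟩
  simp

lemma γ_h_smul_eta (t : (F p)ˣ) : γ p k (h p t) • eta p k = eta p k := by
  refine (Submodule.Quotient.eq (Nmod p k 1)).mpr ?_
  have heq : γ p k (h p t) • ((1 : kG p k) - γ p k (sG p)) - (1 - γ p k (sG p)) =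
      (γ p k (h p t) - 1) - γ p k (sG p) • (γ p k (h p t⁻¹) - 1) := by
    simp only [smul_eq_mul, mul_sub, mul_one, ← γ_mul, h_mul_sG]
    abel
  rw [heq]
  exact Submodule.sub_mem _ (γ_h_sub_one_mem p k t)
    (Submodule.smul_mem _ _ (γ_h_sub_one_mem p k t⁻¹))

lemma gSt_eps_E (u x : F p) : gSt p k (eps p u) (E p k x) = E p k (u + x) := by
  apply Subtype.ext
  change γ p k (eps p u) • γ p k (eps p x) • eta p k = γ p k (eps p (u + x)) • eta p k
  rw [γ_smul_smul, eps_mul_eps]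

lemma gSt_h_E (t : (F p)ˣ) (x : F p) :
    gSt p k (h p t) (E p k x) = E p k ((t : F p) ^ 2 * x) := by
  apply Subtype.ext
  change γ p k (h p t) • γ p k (eps p x) • eta p k =
    γ p k (eps p ((t : F p) ^ 2 * x)) • eta p k
  rw [γ_smul_smul, h_mul_eps, ← γ_smul_smul, γ_h_smul_eta]

lemma gTT_eps_ω (u x y : F p) :
    gTT p k (eps p u) (ω p k x y) = ω p k (u + x) (u + y) := by
  simp [gTT, ω, gSt_eps_E]

lemma gTT_h_ω (t : (F p)ˣ) (x y : F p) :
    gTT p k (h p t) (ω p k x y) = ω p k ((t : F p) ^ 2 * x) ((t : F p) ^ 2 * y) := by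
  simp [gTT, ω, gSt_h_E]

lemma sum_sum_ω (S : Finset (F p)) :
    ∑ v ∈ S, ∑ w ∈ S, ω p k v w = (∑ u ∈ S, E p k u) ⊗ₜ[k] (∑ u ∈ S, E p k u) := by
  simp only [ω, ← Finset.smul_sum, Finset.sum_add_distrib]
  rw [Finset.sum_comm (f := fun v w => E p k w ⊗ₜ[k] E p k v), ← two_smul k, smul_smul,
    inv_mul_cancel₀ two_ne_zero, one_smul, TensorProduct.sum_tmul]
  simp only [TensorProduct.tmul_sum]

/-- `[D_{q^n}]·[U_{q^n}]·ω_{z,z} = (qⁿ−1)·[U_{q^n}]·ω_{0,0}` and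
`[D_{q^n}]·[U_{q^n}]·ω_{x,y} = ([U_{q^n}]η) ⊗ ([U_{q^n}]η) − [U_{q^n}]·ω_{0,0}`
for `x ≠ y`. -/
theorem stmt14 (hp2 : p ≠ 2) (q n : ℕ) (hq : ∃ m : ℕ, 0 < m ∧ q = p ^ m) (hn : 1 ≤ n)
    (Fqn : Finset (F p)) (hFqn : ∀ x : F p, x ∈ Fqn ↔ x ^ q ^ n = x)
    (D : Finset (F p)ˣ)
    (hD : Set.BijOn (fun t : (F p)ˣ => (t : F p) ^ 2) ↑D
      {x : F p | x ^ q ^ n = x ∧ x ≠ 0})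
    (z x y : F p) (hz : z ∈ Fqn) (hx : x ∈ Fqn) (hy : y ∈ Fqn) (hxy : x ≠ y) :
    ∑ t ∈ D, ∑ u ∈ Fqn, gTT p k (h p t) (gTT p k (eps p u) (ω p k z z)) =
      ((q ^ n - 1 : ℕ) : k) • ∑ u ∈ Fqn, gTT p k (eps p u) (ω p k 0 0) ∧
    ∑ t ∈ D, ∑ u ∈ Fqn, gTT p k (h p t) (gTT p k (eps p u) (ω p k x y)) =
      (∑ u ∈ Fqn, E p k u) ⊗ₜ[k] (∑ u ∈ Fqn, E p k u) -
        ∑ u ∈ Fqn, gTT p k (eps p u) (ω p k 0 0) := by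
  classical
  obtain ⟨m, hm, rfl⟩ := hq
  simp only [← pow_mul] at hFqn hD ⊢
  have hmn : m * n ≠ 0 := by positivity
  set L := frobeniusFixed p (m * n)
  have hS : ∀ x, x ∈ Fqn ↔ x ∈ L := fun x => (hFqn x).trans (mem_frobeniusFixed p).symm
  have hcard := card_eq_of_mem_iff_pow_eq p Fqn hmn hFqn
  have hsum : ∀ f : F p → StT p k,
      ∑ t ∈ D, f ((t : F p) ^ 2) = ∑ c ∈ Fqn.erase 0, f c := by
    intro f
    have hset : {x : F p | x ^ p ^ (m * n) = x ∧ x ≠ 0} = ↑(Fqn.erase 0) := by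
      ext c
      simp [hFqn, and_comm (a := c ^ p ^ (m * n) = c)]
    rw [hset] at hD
    exact Finset.sum_nbij _ hD.mapsTo hD.injOn hD.surjOn fun _ _ => rfl
  have hdiag : ∀ u, gTT p k (eps p u) (ω p k 0 0) = ω p k u u := by
    intro u
    rw [gTT_eps_ω, add_zero]
  simp only [hdiag]
  simp only [gTT_eps_ω, gTT_h_ω]
  rw [hsum fun c => ∑ u ∈ Fqn, ω p k (c * (u + z)) (c * (u + z)),
    hsum fun c => ∑ u ∈ Fqn, ω p k (c * (u + x)) (c * (u + y))]
  constructor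
  · have hconst : ∀ c ∈ Fqn.erase 0, ∑ u ∈ Fqn, ω p k (c * (u + z)) (c * (u + z)) =
        ∑ u ∈ Fqn, ω p k u u := by
      intro c hc
      rw [Finset.mem_erase, hS] at hc
      exact L.sum_mul_add_left Fqn hS (fun v => ω p k v v) hc.2 hc.1 ((hS z).mp hz)
    rw [Finset.sum_congr rfl hconst, Finset.sum_const,
      Finset.card_erase_of_mem ((hS 0).mpr L.zero_mem), hcard, Nat.cast_smul_eq_nsmul]
  · rw [L.sum_erase_zero_sum_mul_add Fqn hS _ ((hS x).mp hx) ((hS y).mp hy) hxy,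
      ← sum_sum_ω, eq_sub_iff_add_eq, ← Finset.sum_add_distrib]
    exact Finset.sum_congr rfl fun v hv => Finset.sum_erase_add _ _ hv

end SL2X
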